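/- arXiv:math/0605101 — 2 statements merged into one kernel-verified Lean document; each statement's English description precedes it below -/
import Mathlib

section
/- If 𝔞 is a nonzero ideal of 𝓞_K whose relative norm N_{K/F}(𝔞) is a principal ideal of 𝓞_F, then 𝔞 and 𝓞_K are isomorphic as 𝓞_F-modules. -/
open NumberField
open scoped nonZeroDivisors

/-- The relative norm ideal `N_{K/F}(𝔞)`: the ideal of `𝓞 F` generated by the relative
(field) norms of the elements of `𝔞`. -/
noncomputable def relNormIdeal (F : Type*) {K : Type*} [Field F] [Field K]
    [NumberField F] [NumberField K] [Algebra F K] (𝔞 : Ideal (𝓞 K)) : Ideal (𝓞 F) :=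
  Ideal.span {y : 𝓞 F | ∃ x ∈ 𝔞, algebraMap (𝓞 F) F y = Algebra.norm F (algebraMap (𝓞 K) K x)}

section Steinitz

variable {R F V : Type*} [CommRing R] [Field F] [Algebra R F] [AddCommGroup V] [Module F V]
  [Module R V]

/-- The `R`-module generated by the determinants, in the basis `b`, of pairs of elements of `M`. -/
def detSpan (b : Module.Basis (Fin 2) F V) (M : Submodule R V) : Submodule R F :=
  Submodule.span R {d | ∃ x ∈ M, ∃ y ∈ M, b.det ![x, y] = d}

theorem det_mem_detSpan (b : Module.Basis (Fin 2) F V) {M : Submodule R V} {x y : V}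
    (hx : x ∈ M) (hy : y ∈ M) : b.det ![x, y] ∈ detSpan b M :=
  Submodule.subset_span ⟨x, hx, y, hy, rfl⟩

variable [IsDedekindDomain R] [IsFractionRing R F]

/-- Steinitz: `I ⊕ J ≃ R ⊕ I J` for nonzero fractional ideals of a Dedekind domain. -/
theorem FractionalIdeal.nonempty_prod_equiv {I J : FractionalIdeal R⁰ F} (hI : I ≠ 0)
    (hJ : J ≠ 0) :
    Nonempty ((↥(I : Submodule R F) × ↥(J : Submodule R F)) ≃ₗ[R]
      R × ↥((I * J : FractionalIdeal R⁰ F) : Submodule R F)) := by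
  obtain ⟨b, hb, hb0⟩ : ∃ b ∈ J⁻¹, b ≠ 0 := by
    by_contra! h
    exact inv_ne_zero hJ (FractionalIdeal.eq_zero_iff.2 h)
  have hbJ : FractionalIdeal.spanSingleton R⁰ b * J ≤ 1 := by
    rw [← inv_mul_cancel₀ hJ]
    gcongr
    simpa using hb
  obtain ⟨a, ha⟩ := IsDedekindDomain.exists_add_spanSingleton_mul_eq hbJ
    (mul_ne_zero (FractionalIdeal.spanSingleton_ne_zero_iff.2 hb0) hJ) hI
  have hbJ' : ∀ y ∈ J, ∃ r : R, algebraMap R F r = b * y := fun y hy ↦ by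
    simpa using hbJ (FractionalIdeal.mul_mem_mul (FractionalIdeal.mem_spanSingleton_self _ b) hy)
  have haI : FractionalIdeal.spanSingleton R⁰ a * I ≤ 1 := by
    rw [← ha, ← FractionalIdeal.sup_eq_add]; exact le_sup_right
  have haI' : ∀ y ∈ I, ∃ r : R, algebraMap R F r = a * y := fun y hy ↦ by
    simpa using haI (FractionalIdeal.mul_mem_mul (FractionalIdeal.mem_spanSingleton_self _ a) hy)
  have ha' : a ∈ I⁻¹ := (FractionalIdeal.mem_inv_iff hI).2 fun y hy ↦ by
    simpa using haI' y hy
  obtain ⟨v, hv, u, hu, h1⟩ : ∃ v ∈ J, ∃ u ∈ I, b * v + a * u = 1 := by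
    have : (1 : F) ∈ FractionalIdeal.spanSingleton R⁰ b * J
        + FractionalIdeal.spanSingleton R⁰ a * I := by
      rw [ha]; exact FractionalIdeal.one_mem_one _
    rw [← FractionalIdeal.mem_coe, FractionalIdeal.coe_add, Submodule.add_eq_sup,
      Submodule.mem_sup] at this
    obtain ⟨y, hy, z, hz, h⟩ := this
    obtain ⟨v, hv, rfl⟩ := FractionalIdeal.mem_singleton_mul.1 hy
    obtain ⟨u, hu, rfl⟩ := FractionalIdeal.mem_singleton_mul.1 hz
    exact ⟨v, hv, u, hu, h⟩
  have hs : ∀ p : ↥(I : Submodule R F) × ↥(J : Submodule R F),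
      ∃ r : R, algebraMap R F r = a * p.1 + b * p.2 := fun p ↦ by
    obtain ⟨r, hr⟩ := haI' _ p.1.2
    obtain ⟨s, hs⟩ := hbJ' _ p.2.2
    exact ⟨r + s, by rw [map_add, hr, hs]⟩
  choose s hs using hs
  have hinj := IsFractionRing.injective R F
  let f : (↥(I : Submodule R F) × ↥(J : Submodule R F)) →ₗ[R]
      R × ↥((I * J : FractionalIdeal R⁰ F) : Submodule R F) :=
    { toFun p := (s p, ⟨u * p.2 - v * p.1, sub_mem (FractionalIdeal.mul_mem_mul hu p.2.2)
        (mul_comm (p.1 : F) v ▸ FractionalIdeal.mul_mem_mul p.1.2 hv)⟩)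
      map_add' p q := by
        ext
        · apply hinj
          simp [hs]; ring
        · simp; ring
      map_smul' r p := by
        ext
        · apply hinj
          simp [hs, Algebra.smul_def]; ring
        · simp [Algebra.smul_def]; ring }
  refine ⟨LinearEquiv.ofBijective f ⟨?_, ?_⟩⟩
  · rw [← LinearMap.ker_eq_bot, LinearMap.ker_eq_bot']
    rintro ⟨⟨x, hx⟩, ⟨y, hy⟩⟩ h
    have e1 : a * x + b * y = 0 := by
      rw [← hs ⟨⟨x, hx⟩, ⟨y, hy⟩⟩, show s ⟨⟨x, hx⟩, ⟨y, hy⟩⟩ = 0 from congrArg Prod.fst h, map_zero]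
    have e2 : u * y - v * x = 0 := congrArg (fun q ↦ (q.2 : F)) h
    have hx0 : x = 0 := by linear_combination -x * h1 + u * e1 - b * e2
    have hy0 : y = 0 := by linear_combination -y * h1 + v * e1 + a * e2
    subst hx0 hy0
    rfl
  · rintro ⟨r, ⟨t, ht⟩⟩
    have hx : algebraMap R F r * u - b * t ∈ (I : Submodule R F) := by
      refine sub_mem ?_ ?_
      · rw [← Algebra.smul_def]; exact Submodule.smul_mem _ _ hu
      · have : b * t ∈ J⁻¹ * (I * J) := FractionalIdeal.mul_mem_mul hb ht
        rwa [mul_left_comm, inv_mul_cancel₀ hJ, mul_one] at this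
    have hy : algebraMap R F r * v + a * t ∈ (J : Submodule R F) := by
      refine add_mem ?_ ?_
      · rw [← Algebra.smul_def]; exact Submodule.smul_mem _ _ hv
      · have : a * t ∈ I⁻¹ * (I * J) := FractionalIdeal.mul_mem_mul ha' ht
        rwa [inv_mul_cancel_left₀ hI] at this
    refine ⟨⟨⟨_, hx⟩, ⟨_, hy⟩⟩, Prod.ext (hinj ?_) (Subtype.ext ?_)⟩
    · refine (hs _).trans ?_
      linear_combination algebraMap R F r * h1
    · change u * (algebraMap R F r * v + a * t) - v * (algebraMap R F r * u - b * t) = t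
      linear_combination t * h1

variable [IsScalarTower R F V]

/-- A finitely generated `R`-submodule `M` of a plane is isomorphic to `R ⊕ detSpan b M`. -/
theorem nonempty_equiv_prod_detSpan (b : Module.Basis (Fin 2) F V) {M : Submodule R V}
    (hM : M.FG) (h0 : detSpan b M ≠ ⊥) : Nonempty (M ≃ₗ[R] R × detSpan b M) := by
  have hdet (x y : V) : b.det ![x, y] =
      b.coord 0 x * b.coord 1 y - b.coord 0 y * b.coord 1 x := by
    simp [Module.Basis.det_apply, Matrix.det_fin_two, Module.Basis.toMatrix_apply]
  have hb10 : b.coord 1 (b 0) = 0 := by simp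
  have hb00 : b.coord 0 (b 0) = 1 := by simp
  let f : V →ₗ[R] F := (b.coord 1).restrictScalars R
  let g : F →ₗ[R] V := ((LinearMap.id (R := F) (M := F)).smulRight (b 0)).restrictScalars R
  have hg (t : F) : g t = t • b 0 := rfl
  have hf (x : V) : f x = b.coord 1 x := rfl
  have hfg (t : F) : f (g t) = 0 := by rw [hg, hf, map_smul, hb10, smul_zero]
  let J : FractionalIdeal R⁰ F := ⟨M.map f, FractionalIdeal.isFractional_of_fg (hM.map f)⟩
  have hfr : IsFractional R⁰ (M.map ((b.coord 0).restrictScalars R)) :=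
    FractionalIdeal.isFractional_of_fg (hM.map _)
  let I : FractionalIdeal R⁰ F := ⟨M.comap g, by
    refine FractionalIdeal.isFractional_of_le (J := ⟨_, hfr⟩) fun t ht ↦ ⟨g t, ht, ?_⟩
    simp [hg]⟩
  have hI (t : F) : t ∈ I ↔ g t ∈ M := Iff.rfl
  have hJ0 : J ≠ 0 := fun h ↦ h0 <| by
    have hz : ∀ x ∈ M, b.coord 1 x = 0 := fun x hx ↦
      FractionalIdeal.eq_zero_iff.1 h _ (Submodule.mem_map_of_mem (f := f) hx)
    rw [detSpan, Submodule.span_eq_bot]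
    rintro _ ⟨x, hx, y, hy, rfl⟩
    rw [hdet, hz x hx, hz y hy]; ring
  have hproj : Module.Projective R ↥(J : Submodule R F) :=
    Submodule.projective_of_isUnit ((isUnit_iff_ne_zero.2 hJ0).map
      (FractionalIdeal.coeSubmoduleHom R⁰ F))
  let fM : M →ₗ[R] ↥(J : Submodule R F) := f.submoduleMap M
  obtain ⟨s, hs⟩ := Module.projective_lifting_property fM LinearMap.id
    (f.submoduleMap_surjective M)
  have hs' (j : ↥(J : Submodule R F)) : f (s j) = j :=
    congrArg Subtype.val (LinearMap.congr_fun hs j)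
  have hss (j j' : ↥(J : Submodule R F)) : b.det ![(s j : V), s j'] = 0 := by
    obtain ⟨a, q, hq, e⟩ := IsFractionRing.div_surjective (A := R) (j : F)
    obtain ⟨a', q', hq', e'⟩ := IsFractionRing.div_surjective (A := R) (j' : F)
    by_cases ha : a = 0
    · have : j = 0 := Subtype.ext (by simp [← e, ha])
      simp [hdet, this]
    have hinj := IsFractionRing.injective R F
    have ha0 := (map_ne_zero_iff _ hinj).2 ha
    have hq0 := (map_ne_zero_iff _ hinj).2 (nonZeroDivisors.ne_zero hq)
    have hq0' := (map_ne_zero_iff _ hinj).2 (nonZeroDivisors.ne_zero hq')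
    have h : (a' * q) • j = (a * q') • j' := Subtype.ext <| by
      simp only [Submodule.coe_smul, Algebra.smul_def, map_mul, ← e, ← e']
      field_simp
    have hc (k : Fin 2) : algebraMap R F (a' * q) * b.coord k (s j) =
        algebraMap R F (a * q') * b.coord k (s j') := by
      have := congrArg (fun x : M ↦ b.coord k x) (congrArg s h)
      simpa only [map_smul, Submodule.coe_smul, ← algebraMap_smul F (_ : R) (_ : V),
        smul_eq_mul] using this
    refine (mul_eq_zero_iff_left (mul_ne_zero ha0 hq0')).1 ?_
    rw [hdet, ← map_mul]
    linear_combination b.coord 1 (s j) * hc 0 - b.coord 0 (s j) * hc 1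
  have hdec (x : M) : ∃ i ∈ I, ∃ j, (x : V) = g i + s j := by
    refine ⟨b.coord 0 (x - s (fM x)), ?_, fM x, ?_⟩
    all_goals
      have : g (b.coord 0 (x - s (fM x))) = x - s (fM x) := by
        refine b.ext_elem fun k ↦ ?_
        have h1 : b.coord 1 (x - s (fM x)) = 0 := by
          rw [map_sub, ← hf, ← hf, hs']; exact sub_self _
        fin_cases k
        · simp [hg]
        · simpa [hg] using h1.symm
    · rw [hI, this]; exact sub_mem x.2 (s _).2
    · rw [this]; abel
  have hIJ : ((I * J : FractionalIdeal R⁰ F) : Submodule R F) = detSpan b M := by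
    rw [FractionalIdeal.coe_mul]
    refine le_antisymm (Submodule.mul_le.2 fun i hi j hj ↦ ?_) (Submodule.span_le.2 ?_)
    · convert det_mem_detSpan b hi (s ⟨j, hj⟩).2 using 1
      rw [hdet, ← hf, ← hf, hfg, hs', hg, map_smul, hb00]
      simp
    · rintro _ ⟨x, hx, y, hy, rfl⟩
      obtain ⟨i, hi, j, hxj : x = _⟩ := hdec ⟨x, hx⟩
      obtain ⟨i', hi', j', hyj : y = _⟩ := hdec ⟨y, hy⟩
      have : b.det ![x, y] = i * j' - i' * j := by
        have h := hss j j'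
        rw [hdet, ← hf, ← hf, hs', hs'] at h
        rw [hdet, ← hf, ← hf, hxj, hyj]
        simp only [map_add, hfg, hs']
        simp only [hg, map_smul, hb00, smul_eq_mul]
        linear_combination h
      rw [this]
      exact sub_mem (Submodule.mul_mem_mul hi j'.2) (Submodule.mul_mem_mul hi' j.2)
  have hI0 : I ≠ 0 := fun h ↦ h0 <| by rw [← hIJ, h, zero_mul, FractionalIdeal.coe_zero]
  let φ : (↥(I : Submodule R F) × ↥(J : Submodule R F)) →ₗ[R] M :=
    (g.restrict (p := (I : Submodule R F)) (q := M) fun t ht ↦ ht).coprod s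
  have hφ : Function.Bijective φ := by
    constructor
    · rw [← LinearMap.ker_eq_bot, LinearMap.ker_eq_bot']
      rintro ⟨i, j⟩ h
      have h1 : g i + s j = 0 := congrArg Subtype.val h
      have hj : j = 0 := Subtype.ext <| by simpa [hfg, hs'] using congrArg f h1
      subst hj
      have hi : i = 0 := Subtype.ext <| by simpa [hg, b.ne_zero] using h1
      rw [hi]; rfl
    · intro x
      obtain ⟨i, hi, j, e⟩ := hdec x
      exact ⟨(⟨i, hi⟩, j), Subtype.ext e.symm⟩
  obtain ⟨e⟩ := FractionalIdeal.nonempty_prod_equiv hI0 hJ0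
  exact ⟨(LinearEquiv.ofBijective φ hφ).symm.trans
    (e.trans ((LinearEquiv.refl R R).prodCongr (LinearEquiv.ofEq _ _ hIJ)))⟩

open scoped Pointwise in
/-- Lattices in a plane whose determinant modules differ by a scalar are isomorphic. -/
theorem nonempty_equiv_of_detSpan_eq_smul (b : Module.Basis (Fin 2) F V) {M N : Submodule R V}
    (hM : M.FG) (hN : N.FG) (h0 : detSpan b M ≠ ⊥) {r : R}
    (h : detSpan b M = r • detSpan b N) : Nonempty (M ≃ₗ[R] N) := by
  have hr : r ≠ 0 := by
    rintro rfl
    exact h0 (by simpa using h)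
  have hN0 : detSpan b N ≠ ⊥ := fun hb ↦ h0 (by rw [h, hb, Submodule.smul_bot'])
  obtain ⟨e⟩ := nonempty_equiv_prod_detSpan b hM h0
  obtain ⟨e'⟩ := nonempty_equiv_prod_detSpan b hN hN0
  have hinj : Function.Injective (DistribSMul.toLinearMap R F r) := fun x y hxy ↦ by
    have := (IsFractionRing.injective R F).ne hr
    simpa [Algebra.smul_def, this, hr] using hxy
  let i : detSpan b N ≃ₗ[R] detSpan b M :=
    (Submodule.equivMapOfInjective _ hinj _).trans (LinearEquiv.ofEq _ _ h.symm)
  exact ⟨e.trans (((LinearEquiv.refl R R).prodCongr i.symm).trans e'.symm)⟩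

end Steinitz

theorem Module.Basis.det_mul_mul {F K : Type*} [Field F] [Field K] [Algebra F K]
    (b : Module.Basis (Fin 2) F K) (x u v : K) :
    b.det ![x * u, x * v] = Algebra.norm F x * b.det ![u, v] := by
  rw [Algebra.norm_apply, ← Module.Basis.det_comp]
  congr 1
  ext i
  fin_cases i <;> rfl

open scoped Pointwise in
theorem Submodule.le_of_ideal_smul_le {A F : Type*} [CommRing A] [IsDedekindDomain A] [Field F]
    [Algebra A F] [IsFractionRing A F] {I : Ideal A} (hI : I ≠ ⊥)
    {M N : Submodule A F} (h : I • M ≤ I • N) : M ≤ N := by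
  obtain ⟨r, hr, hr0⟩ := Submodule.exists_mem_ne_zero_of_ne_bot hI
  obtain ⟨J, hJ⟩ := Ideal.dvd_span_singleton.2 hr
  have h' : r • M ≤ r • N := by
    rw [← Submodule.ideal_span_singleton_smul, ← Submodule.ideal_span_singleton_smul, hJ, mul_comm,
      mul_smul, mul_smul]
    exact Submodule.smul_mono le_rfl h
  intro x hx
  obtain ⟨y, hy, e : r • y = r • x⟩ := h' (Submodule.smul_mem_pointwise_smul x r M hx)
  have := (map_ne_zero_iff _ (IsFractionRing.injective A F)).2 hr0
  rw [Algebra.smul_def, Algebra.smul_def] at e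
  exact mul_left_cancel₀ this e ▸ hy

section RelNorm

variable (A : Type*) {F B K : Type*} [CommRing A] [CommRing B] [Field F] [Field K] [Algebra A B]
  [Algebra A F] [Algebra B K] [Algebra F K] [Algebra A K] [IsScalarTower A B K]

/-- An ideal of `B`, viewed as an `A`-submodule of `K`. -/
def Ideal.toSubmoduleOver (K : Type*) [Field K] [Algebra B K] [Algebra A K] [IsScalarTower A B K]
    (I : Ideal B) : Submodule A K :=
  (I.restrictScalars A).map (IsScalarTower.toAlgHom A B K).toLinearMap

variable [IsDedekindDomain A] [IsDedekindDomain B] [IsFractionRing A F]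
  [IsFractionRing B K] [IsScalarTower A F K] [FiniteDimensional F K]

variable {A} (b : Module.Basis (Fin 2) F K)

theorem detSpan_top_ne_bot : detSpan b ((⊤ : Ideal B).toSubmoduleOver A K) ≠ ⊥ := by
  have : Algebra.IsAlgebraic A K := (IsFractionRing.comap_isAlgebraic_iff (K := F)).2 inferInstance
  classical
  obtain ⟨r, hr, h⟩ := Algebra.IsAlgebraic.exists_integral_multiples A {b 0, b 1}
  have hmem (i : Fin 2) :
      algebraMap A F r • b i ∈ (⊤ : Ideal B).toSubmoduleOver A K := by
    have hi : IsIntegral A (r • b i) := h _ (by fin_cases i <;> simp)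
    obtain ⟨x, hx⟩ := IsIntegrallyClosed.isIntegral_iff.1 (hi.tower_top (A := B))
    exact ⟨x, trivial, by rw [algebraMap_smul]; exact hx⟩
  have hd := det_mem_detSpan b (hmem 0) (hmem 1)
  intro h0
  rw [h0, Submodule.mem_bot] at hd
  have hr' := (map_ne_zero_iff _ (IsFractionRing.injective A F)).2 hr
  simp [Module.Basis.det_apply, Matrix.det_fin_two, Module.Basis.toMatrix_apply, hr',
    -algebraMap_smul] at hd

variable [Module.Finite A B] [Module.IsTorsionFree A B]

theorem relNorm_smul_detSpan_le (I J : Ideal B) :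
    Ideal.relNorm A I • detSpan b (J.toSubmoduleOver A K) ≤
      detSpan b ((I * J).toSubmoduleOver A K) := by
  rw [Ideal.relNorm_apply, detSpan, Submodule.span_smul_span, Submodule.span_le]
  rintro _ ⟨_, ⟨x, hx, rfl⟩, _, ⟨_, ⟨u, hu, rfl⟩, _, ⟨v, hv, rfl⟩, rfl⟩, rfl⟩
  simp only [Algebra.smul_def]
  rw [Algebra.algebraMap_intNorm (L := K), ← Module.Basis.det_mul_mul]
  exact det_mem_detSpan b ⟨x * u, Ideal.mul_mem_mul hx hu, map_mul (algebraMap B K) _ _⟩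
    ⟨x * v, Ideal.mul_mem_mul hx hv, map_mul (algebraMap B K) _ _⟩

theorem detSpan_span_singleton_le (c : B) :
    detSpan b ((Ideal.span {c}).toSubmoduleOver A K) ≤
      Ideal.relNorm A (Ideal.span {c}) • detSpan b ((⊤ : Ideal B).toSubmoduleOver A K) := by
  rw [Ideal.relNorm_singleton, detSpan, Submodule.span_le]
  rintro _ ⟨_, ⟨u, hu, rfl⟩, _, ⟨v, hv, rfl⟩, rfl⟩
  obtain ⟨u, rfl⟩ := Ideal.mem_span_singleton.1 hu
  obtain ⟨v, rfl⟩ := Ideal.mem_span_singleton.1 hv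
  simp only [AlgHom.coe_toLinearMap, map_mul]
  rw [Module.Basis.det_mul_mul, IsScalarTower.coe_toAlgHom', ← Algebra.algebraMap_intNorm (A := A) (K := F),
    ← Algebra.smul_def]
  exact Submodule.smul_mem_smul (Ideal.mem_span_singleton_self _)
    (det_mem_detSpan b ⟨u, trivial, rfl⟩ ⟨v, trivial, rfl⟩)

/-- The determinant module of an ideal is its relative norm times that of the full ring. -/
theorem detSpan_toSubmoduleOver {I : Ideal B} (hI : I ≠ ⊥) :
    detSpan b (I.toSubmoduleOver A K) =
      Ideal.relNorm A I • detSpan b ((⊤ : Ideal B).toSubmoduleOver A K) := by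
  refine le_antisymm ?_ (by simpa using relNorm_smul_detSpan_le b I ⊤)
  obtain ⟨c, hc, hc0⟩ := Submodule.exists_mem_ne_zero_of_ne_bot hI
  obtain ⟨J, hJ⟩ := Ideal.dvd_span_singleton.2 hc
  have hJ0 : J ≠ ⊥ := by
    rintro rfl
    exact hc0 (by simpa using hJ)
  refine Submodule.le_of_ideal_smul_le (mt Ideal.relNorm_eq_bot_iff.1 hJ0) ?_
  rw [← mul_smul, ← map_mul, mul_comm J I, ← hJ]
  refine le_trans ?_ (detSpan_span_singleton_le b c)
  rw [hJ, mul_comm I J]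
  exact relNorm_smul_detSpan_le b J I

end RelNorm

theorem relNormIdeal_eq_relNorm (F : Type*) {K : Type*} [Field F] [Field K]
    [NumberField F] [NumberField K] [Algebra F K] (I : Ideal (𝓞 K)) :
    relNormIdeal F I = Ideal.relNorm (𝓞 F) I := by
  rw [relNormIdeal, Ideal.relNorm_apply]
  congr 1
  ext y
  simp only [Set.mem_ofPred_eq, Set.mem_image, SetLike.mem_coe,
    ← Algebra.algebraMap_intNorm (A := 𝓞 F), (IsFractionRing.injective (𝓞 F) F).eq_iff, eq_comm]

/-- If `𝔞` is a nonzero ideal of `𝓞 K` whose relative norm `N_{K/F}(𝔞)` is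
a principal ideal of `𝓞 F`, then `𝔞` and `𝓞 K` are isomorphic as `𝓞 F`-modules. -/
theorem ideal_isomorphic_ringOfIntegers_of_relNorm_principal
    (F K : Type*) [Field F] [Field K] [NumberField F] [NumberField K] [Algebra F K]
    (hF : ∀ v : InfinitePlace F, v.IsReal)
    (hK : ∀ v : InfinitePlace K, v.IsComplex)
    (hdeg : Module.finrank F K = 2)
    (𝔞 : Ideal (𝓞 K)) (h𝔞 : 𝔞 ≠ 0)
    (hprin : (relNormIdeal F 𝔞).IsPrincipal) :
    Nonempty (↥𝔞 ≃ₗ[𝓞 F] 𝓞 K) := by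
  let b : Module.Basis (Fin 2) F K := Module.finBasisOfFinrankEq F K hdeg
  obtain ⟨r, hr⟩ := hprin
  rw [relNormIdeal_eq_relNorm] at hr
  have hinj : Function.Injective (IsScalarTower.toAlgHom (𝓞 F) (𝓞 K) K).toLinearMap :=
    IsFractionRing.injective (𝓞 K) K
  have hfg (I : Ideal (𝓞 K)) : (I.toSubmoduleOver (𝓞 F) K).FG :=
    (IsNoetherian.noetherian (I.restrictScalars (𝓞 F))).map _
  have hsmul := detSpan_toSubmoduleOver (A := 𝓞 F) b h𝔞
  have h0 : detSpan b (𝔞.toSubmoduleOver (𝓞 F) K) ≠ ⊥ := fun h ↦ by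
    refine detSpan_top_ne_bot (A := 𝓞 F) (B := 𝓞 K) b (le_bot_iff.1 ?_)
    refine Submodule.le_of_ideal_smul_le (mt Ideal.relNorm_eq_bot_iff.1 h𝔞) ?_
    rw [← hsmul, h]; exact bot_le
  rw [hr, Ideal.submodule_span_eq, Submodule.ideal_span_singleton_smul] at hsmul
  obtain ⟨e⟩ := nonempty_equiv_of_detSpan_eq_smul b (hfg _) (hfg _) h0 hsmul
  exact ⟨(Submodule.equivMapOfInjective _ hinj (𝔞.restrictScalars (𝓞 F))).trans <| e.trans <|
    (Submodule.equivMapOfInjective _ hinj ((⊤ : Ideal (𝓞 K)).restrictScalars (𝓞 F))).symm.trans <|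
    (LinearEquiv.ofEq _ ⊤ rfl).trans Submodule.topEquiv⟩
end

section
/- Let K be a totally imaginary number field of degree 2n over ℚ, with regulator R_K, with w_K the number of roots of unity in K, and with discriminant d_K. For every ideal class C of K, the partial zeta function ζ_K(s,C) = Σ N(𝔞)^{−s}, the sum being over all nonzero integral ideals 𝔞 of 𝓞_K whose ideal class is C, satisfies: (s−1)·ζ_K(s,C) tends to (2π)^n R_K / (w_K |d_K|^{1/2}) as real s tends to 1 from the right. In particular the residue is the same for every ideal class C. -/
open NumberField Filter Topology
open scoped nonZeroDivisors

/-- A series whose terms depend on `i` only through `N i ∈ ℕ` is the series over `ℕ` weighted by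
the cardinality of the fibers of `N`, provided the terms are nonnegative and the fibers finite. -/
theorem tsum_comp_eq_tsum_card_fiber_mul {ι : Type*} (N : ι → ℕ)
    (hN : ∀ m, Finite {i // N i = m}) {g : ℕ → ℝ} (hg : ∀ m, 0 ≤ g m) :
    ∑' i, g (N i) = ∑' m, (Nat.card {i // N i = m} : ℝ) * g m := by
  have key : ∑' i, ENNReal.ofReal (g (N i)) =
      ∑' m, (Nat.card {i // N i = m} : ENNReal) * ENNReal.ofReal (g m) := by
    rw [← (Equiv.sigmaFiberEquiv N).tsum_eq, ENNReal.tsum_sigma']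
    refine tsum_congr fun m ↦ ?_
    have := hN m
    rw [← ENat.toENNReal_coe, ← ENat.card_eq_coe_natCard, ← ENNReal.tsum_const]
    exact tsum_congr fun i ↦ by rw [Equiv.sigmaFiberEquiv_apply, i.2]
  have h := congrArg ENNReal.toReal key
  rw [ENNReal.tsum_toReal_eq fun _ ↦ ENNReal.ofReal_ne_top, ENNReal.tsum_toReal_eq fun _ ↦
    ENNReal.mul_ne_top (ENNReal.natCast_ne_top _) ENNReal.ofReal_ne_top] at h
  simpa [ENNReal.toReal_ofReal, hg] using h

section

variable {K : Type*} [Field K] [NumberField K]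

theorem finite_ideals_in_class_absNorm_eq (C : ClassGroup (𝓞 K)) (m : ℕ) :
    Finite {I : {I : (Ideal (𝓞 K))⁰ // ClassGroup.mk0 I = C} // Ideal.absNorm I.1.1 = m} := by
  have := (Ideal.finite_setOfPred_absNorm_eq (S := 𝓞 K) m).to_subtype
  refine Finite.of_injective (β := {I : Ideal (𝓞 K) | Ideal.absNorm I = m})
    (fun I ↦ ⟨I.1.1.1, I.2⟩) fun I J h ↦ ?_
  have h : I.1.1.1 = J.1.1.1 := by simpa using h
  exact Subtype.ext (Subtype.ext (Subtype.ext h))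

/-- The partial zeta function of an ideal class, as an `L`-series. -/
theorem ofReal_tsum_class_absNorm_rpow_neg (C : ClassGroup (𝓞 K)) {s : ℝ} :
    ((∑' I : {I : (Ideal (𝓞 K))⁰ // ClassGroup.mk0 I = C},
      (Ideal.absNorm (I.1.1) : ℝ) ^ (-s) : ℝ) : ℂ) =
    LSeries (fun m ↦ ((Nat.card {I : {I : (Ideal (𝓞 K))⁰ // ClassGroup.mk0 I = C} //
      Ideal.absNorm I.1.1 = m} : ℝ) : ℂ)) s := by
  rw [tsum_comp_eq_tsum_card_fiber_mul
    (fun I : {I : (Ideal (𝓞 K))⁰ // ClassGroup.mk0 I = C} ↦ Ideal.absNorm I.1.1)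
    (finite_ideals_in_class_absNorm_eq C) (g := fun m ↦ (m : ℝ) ^ (-s)) (fun m ↦ by positivity),
    Complex.ofReal_tsum, LSeries]
  refine tsum_congr fun m ↦ ?_
  rcases eq_or_ne m 0 with rfl | hm
  · have : IsEmpty {I : {I : (Ideal (𝓞 K))⁰ // ClassGroup.mk0 I = C} //
        Ideal.absNorm I.1.1 = 0} :=
      ⟨fun I ↦ Ideal.absNorm_ne_zero_of_nonZeroDivisors I.1.1 I.2⟩
    simp
  · rw [LSeries.term_of_ne_zero hm, Complex.ofReal_mul, Complex.ofReal_cpow m.cast_nonneg,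
      Complex.ofReal_neg, Complex.cpow_neg, Complex.ofReal_natCast m, div_eq_mul_inv]

theorem sum_card_ideals_in_class_absNorm_eq (C : ClassGroup (𝓞 K)) (n : ℕ) :
    ∑ m ∈ Finset.Icc 1 n, Nat.card {I : {I : (Ideal (𝓞 K))⁰ // ClassGroup.mk0 I = C} //
      Ideal.absNorm I.1.1 = m} =
    Nat.card {I : (Ideal (𝓞 K))⁰ // Ideal.absNorm (I : Ideal (𝓞 K)) ≤ n ∧
      ClassGroup.mk0 I = C} := by
  rw [← Finset.card_preimage_eq_sum_card_image_eq
    (f := fun I : {I : (Ideal (𝓞 K))⁰ // ClassGroup.mk0 I = C} ↦ Ideal.absNorm I.1.1)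
    (fun m _ ↦ finite_ideals_in_class_absNorm_eq C m)]
  refine Nat.card_congr ((Equiv.subtypeEquivRight fun I ↦ ?_).trans
    ((Equiv.subtypeSubtypeEquivSubtypeInter (fun I : (Ideal (𝓞 K))⁰ ↦ ClassGroup.mk0 I = C)
      (fun I ↦ Ideal.absNorm I.1 ≤ n)).trans (Equiv.subtypeEquivRight fun I ↦ and_comm)))
  have := Ideal.absNorm_pos_of_nonZeroDivisors I.1
  simp only [Finset.coe_Icc, Set.mem_preimage, Set.mem_Icc]
  exact and_iff_right this

variable (K) in
/-- The residue at `1` of the partial zeta function of an ideal class, for any number field. -/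
theorem tendsto_sub_one_mul_tsum_class_absNorm_rpow_neg (C : ClassGroup (𝓞 K)) :
    Tendsto
      (fun s : ℝ => (s - 1) * ∑' I : {I : (Ideal (𝓞 K))⁰ // ClassGroup.mk0 I = C},
          (Ideal.absNorm (I.1.1) : ℝ) ^ (-s))
      (𝓝[>] (1 : ℝ))
      (𝓝 ((2 ^ InfinitePlace.nrRealPlaces K * (2 * Real.pi) ^ InfinitePlace.nrComplexPlaces K *
        Units.regulator K) / (Units.torsionOrder K * Real.sqrt |(discr K : ℝ)|))) := by
  rw [← tendsto_ofReal_iff]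
  refine (LSeries_tendsto_sub_mul_nhds_one_of_tendsto_sum_div_and_nonneg
    (fun m ↦ (Nat.card {I : {I : (Ideal (𝓞 K))⁰ // ClassGroup.mk0 I = C} //
      Ideal.absNorm I.1.1 = m} : ℝ)) ?_ (fun _ ↦ Nat.cast_nonneg _)).congr fun s ↦ ?_
  · refine ((Ideal.tendsto_norm_le_and_mk_eq_div_atTop K C).comp
      tendsto_natCast_atTop_atTop).congr fun n ↦ ?_
    simp only [Function.comp_apply, Nat.cast_le, ← Nat.cast_sum]
    rw [sum_card_ideals_in_class_absNorm_eq]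
  · rw [← ofReal_tsum_class_absNorm_rpow_neg]
    push_cast
    rfl

end

/-- Let `K` be a totally imaginary number field of degree `2n` over `ℚ`.
For every ideal class `C` of `K`, the partial zeta function
`ζ_K(s, C) = ∑_{[𝔞] = C} N(𝔞)⁻ˢ` satisfies
`(s − 1) · ζ_K(s, C) → (2π)ⁿ R_K / (w_K √|d_K|)` as `s → 1⁺`. -/
theorem partial_zeta_residue
    (K : Type*) [Field K] [NumberField K] (n : ℕ)
    (hdeg : Module.finrank ℚ K = 2 * n)
    (hK : ∀ v : InfinitePlace K, v.IsComplex)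
    (C : ClassGroup (𝓞 K)) :
    Tendsto
      (fun s : ℝ => (s - 1) *
        ∑' I : {I : (Ideal (𝓞 K))⁰ // ClassGroup.mk0 I = C},
          (Ideal.absNorm (I.1.1) : ℝ) ^ (-s))
      (𝓝[>] (1 : ℝ))
      (𝓝 ((2 * Real.pi) ^ n * NumberField.Units.regulator K /
        (((NumberField.Units.torsionOrder K : ℕ) : ℝ) *
          Real.sqrt |(NumberField.discr K : ℝ)|))) := by
  have : IsTotallyComplex K := ⟨hK⟩
  have hr : InfinitePlace.nrRealPlaces K = 0 := IsTotallyComplex.nrRealPlaces_eq_zero K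
  have hc : InfinitePlace.nrComplexPlaces K = n := by
    have := InfinitePlace.card_add_two_mul_card_eq_rank K
    omega
  simpa only [hr, hc, pow_zero, one_mul] using tendsto_sub_one_mul_tsum_class_absNorm_rpow_neg K C
end
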